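/- With high probability, G_n contains no complete bipartite (not necessarily induced) subgraph with both parts of size at least 3·ln n; that is, the probability that there exist disjoint vertex sets S, T ⊆ [n] with |S| ≥ 3·ln n, |T| ≥ 3·ln n, and every vertex of S adjacent in G_n to every vertex of T, tends to 0 as n → ∞. -/

import Mathlib

open Filter

/-- The probability that a uniformly random graph on the (finite) vertex type `V`
belongs to the set `A`. -/
noncomputable def gprob {V : Type*} (A : Set (SimpleGraph V)) : ℝ :=
  (Nat.card A : ℝ) / 2 ^ (Nat.card V).choose 2

/-- At most a `2 ^ (-|S||T|)` proportion of all graphs joins `S` completely to `T`. -/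
theorem ncard_complete_between_mul_le {V : Type*} [Fintype V] [DecidableEq V] {S T : Finset V}
    (hST : Disjoint S T) :
    {G : SimpleGraph V | ∀ u ∈ S, ∀ v ∈ T, G.Adj u v}.ncard * 2 ^ (S.card * T.card) ≤
      2 ^ (Nat.card V).choose 2 := by
  classical
  set E : Finset (Sym2 V) := (S ×ˢ T).image (fun p => s(p.1, p.2)) with hE
  have hEcard : E.card = S.card * T.card := by
    rw [hE, Finset.card_image_of_injOn, Finset.card_product]
    rintro ⟨a, b⟩ hab ⟨c, d⟩ hcd h
    simp only [Finset.coe_product, Set.mem_prod, Finset.mem_coe] at hab hcd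
    rcases Sym2.eq_iff.1 h with ⟨h1, h2⟩ | ⟨h1, h2⟩
    · exact Prod.ext h1 h2
    · have haT : a ∈ T := (show a = d from h1) ▸ hcd.2
      exact absurd haT (Finset.disjoint_left.1 hST hab.1)
  have hEsub : E ⊆ (⊤ : SimpleGraph V).edgeFinset := by
    intro e he
    obtain ⟨⟨a, b⟩, hab, rfl⟩ := Finset.mem_image.1 he
    rw [Finset.mem_product] at hab
    rw [SimpleGraph.mem_edgeFinset, SimpleGraph.mem_edgeSet, SimpleGraph.top_adj]
    intro h
    exact Finset.disjoint_left.1 hST hab.1 (h ▸ hab.2)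
  have hEG : ∀ G ∈ {G : SimpleGraph V | ∀ u ∈ S, ∀ v ∈ T, G.Adj u v}, E ⊆ G.edgeFinset := by
    intro G hG e he
    obtain ⟨⟨a, b⟩, hab, rfl⟩ := Finset.mem_image.1 he
    rw [Finset.mem_product] at hab
    rw [SimpleGraph.mem_edgeFinset, SimpleGraph.mem_edgeSet]
    exact hG a hab.1 b hab.2
  have hcard : ((⊤ : SimpleGraph V).edgeFinset \ E).card + S.card * T.card =
      (Nat.card V).choose 2 := by
    rw [← hEcard, Finset.card_sdiff_add_card_eq_card hEsub, Nat.card_eq_fintype_card,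
      SimpleGraph.card_edgeFinset_top_eq_card_choose_two]
  rw [← hcard, pow_add, ← Finset.card_powerset]
  refine Nat.mul_le_mul_right _ ?_
  rw [← Set.ncard_coe_finset]
  refine Set.ncard_le_ncard_of_injOn (fun G => G.edgeFinset \ E) ?_ ?_ (Set.toFinite _)
  · intro G _
    rw [Finset.mem_coe, Finset.mem_powerset]
    exact Finset.sdiff_subset_sdiff (SimpleGraph.edgeFinset_mono le_top) le_rfl
  · intro G hG H hH h
    rw [← SimpleGraph.edgeFinset_inj, ← Finset.sdiff_union_of_subset (hEG G hG),
      ← Finset.sdiff_union_of_subset (hEG H hH)]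
    exact congrArg (· ∪ E) h

theorem gprob_nonneg {V : Type*} (A : Set (SimpleGraph V)) : 0 ≤ gprob A := by
  unfold gprob
  positivity

theorem gprob_complete_between_le {V : Type*} [Fintype V] {S T : Finset V}
    (hST : Disjoint S T) :
    gprob {G : SimpleGraph V | ∀ u ∈ S, ∀ v ∈ T, G.Adj u v} ≤ 1 / 2 ^ (S.card * T.card) := by
  classical
  unfold gprob
  rw [div_le_div_iff₀ (by positivity) (by positivity), one_mul]
  exact_mod_cast ncard_complete_between_mul_le hST

theorem gprob_mono {V : Type*} [Finite V] {A B : Set (SimpleGraph V)} (h : A ⊆ B) :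
    gprob A ≤ gprob B := by
  unfold gprob
  gcongr
  exact Set.ncard_le_ncard h (Set.toFinite _)

theorem gprob_biUnion_le {V ι : Type*} (s : Finset ι) (A : ι → Set (SimpleGraph V)) :
    gprob (⋃ i ∈ s, A i) ≤ ∑ i ∈ s, gprob (A i) := by
  unfold gprob
  rw [← Finset.sum_div]
  gcongr
  exact_mod_cast Finset.set_ncard_biUnion_le s A

/-- The first moment bound for copies of `K_{k,k}` in a uniformly random graph. -/
theorem gprob_exists_complete_between_le (n k : ℕ) :
    gprob {G : SimpleGraph (Fin n) | ∃ S T : Finset (Fin n), Disjoint S T ∧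
      k ≤ S.card ∧ k ≤ T.card ∧ ∀ u ∈ S, ∀ v ∈ T, G.Adj u v} ≤
      (n.choose k : ℝ) ^ 2 / 2 ^ (k * k) := by
  classical
  set P : Finset (Finset (Fin n)) := Finset.powersetCard k Finset.univ
  calc
    _ ≤ gprob (⋃ p ∈ (P ×ˢ P).filter (fun p => Disjoint p.1 p.2),
        {G : SimpleGraph (Fin n) | ∀ u ∈ p.1, ∀ v ∈ p.2, G.Adj u v}) := by
      refine gprob_mono ?_
      rintro G ⟨S, T, hST, hS, hT, hG⟩
      obtain ⟨S', hS', hSk⟩ := Finset.exists_subset_card_eq hS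
      obtain ⟨T', hT', hTk⟩ := Finset.exists_subset_card_eq hT
      refine Set.mem_biUnion (x := (S', T')) ?_ fun u hu v hv => hG u (hS' hu) v (hT' hv)
      simp [P, hSk, hTk,
        Finset.disjoint_of_subset_left hS' (Finset.disjoint_of_subset_right hT' hST)]
    _ ≤ ∑ p ∈ (P ×ˢ P).filter (fun p => Disjoint p.1 p.2), 1 / (2 : ℝ) ^ (k * k) := by
      refine (gprob_biUnion_le _ _).trans (Finset.sum_le_sum fun p hp => ?_)
      simp only [P, Finset.mem_filter, Finset.mem_product, Finset.mem_powersetCard_univ] at hp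
      simpa only [hp.1.1, hp.1.2] using gprob_complete_between_le hp.2
    _ ≤ ∑ p ∈ P ×ˢ P, 1 / (2 : ℝ) ^ (k * k) :=
      Finset.sum_le_sum_of_subset_of_nonneg (Finset.filter_subset _ _) fun _ _ _ => by positivity
    _ = _ := by
      simp only [P, Finset.sum_const, Finset.card_product, Finset.card_powersetCard,
        Finset.card_univ, Fintype.card_fin, nsmul_eq_mul, Nat.cast_mul]
      ring

theorem choose_sq_div_two_pow_le {n k : ℕ} (hk : 1 ≤ k) (h : n ^ 2 ≤ 2 ^ k) :
    (n.choose k : ℝ) ^ 2 / 2 ^ (k * k) ≤ 1 / k := by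
  have hfac : (k : ℝ) ≤ (k.factorial : ℝ) ^ 2 := by
    exact_mod_cast (Nat.self_le_factorial k).trans (Nat.le_self_pow two_ne_zero _)
  have hk0 : (0 : ℝ) < k := by exact_mod_cast hk
  have hpow : ((n : ℝ) ^ k) ^ 2 ≤ 2 ^ (k * k) := by
    rw [← pow_mul, mul_comm k 2, pow_mul, pow_mul]
    gcongr
    exact_mod_cast h
  calc
    _ ≤ ((n : ℝ) ^ k / k.factorial) ^ 2 / 2 ^ (k * k) := by
      gcongr
      exact Nat.choose_le_pow_div k n
    _ ≤ (2 ^ (k * k) / k) / 2 ^ (k * k) := by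
      rw [div_pow]
      gcongr
    _ = 1 / k := by field_simp

theorem sq_le_two_pow_of_three_mul_log_le {n k : ℕ} (hn : 1 ≤ n)
    (h : 3 * Real.log n ≤ k) : n ^ 2 ≤ 2 ^ k := by
  have hn0 : (0 : ℝ) < n := by exact_mod_cast hn
  have hlog : 0 ≤ Real.log n := Real.log_natCast_nonneg n
  have : (n : ℝ) ^ 2 ≤ 2 ^ k := by
    rw [← Real.log_le_log_iff (by positivity) (by positivity), Real.log_pow, Real.log_pow]
    push_cast
    nlinarith [Real.log_two_gt_d9]
  exact_mod_cast this

/-- Whp `G_n` contains no complete bipartite (not necessarily induced) subgraph with both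
parts of size at least `3·ln n`. -/
theorem no_large_complete_bipartite_whp :
    Tendsto (fun n : ℕ => gprob {G : SimpleGraph (Fin n) |
      ∃ S T : Finset (Fin n), Disjoint S T ∧
        3 * Real.log n ≤ (S.card : ℝ) ∧ 3 * Real.log n ≤ (T.card : ℝ) ∧
        ∀ u ∈ S, ∀ v ∈ T, G.Adj u v}) atTop (nhds 0) := by
  refine squeeze_zero' (g := fun n : ℕ => 1 / (3 * Real.log n)) (.of_forall fun n => gprob_nonneg _)
    ?_ ?_
  · filter_upwards [eventually_ge_atTop 2] with n hn
    have hlog : 0 < 3 * Real.log n := by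
      have := Real.log_pos (x := n) (by exact_mod_cast hn)
      positivity
    have hle := Nat.le_ceil (3 * Real.log n)
    simp only [← Nat.ceil_le]
    refine (gprob_exists_complete_between_le n _).trans ((choose_sq_div_two_pow_le
      (Nat.ceil_pos.2 hlog) (sq_le_two_pow_of_three_mul_log_le (by lia) hle)).trans ?_)
    gcongr
  · simp only [one_div]
    exact ((Real.tendsto_log_atTop.comp tendsto_natCast_atTop_atTop).const_mul_atTop
      (by norm_num)).inv_tendsto_atTop
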